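/- arXiv:1510.01534 — 2 statements merged into one kernel-verified Lean document; each statement's English description precedes it below -/
import Mathlib

section
/- Let T be a closed densely defined linear operator from H₁ to H₂ and S : H₁ → H₂ a bounded linear operator such that ‖Sx‖ ≤ λ₁‖Tx‖ + λ₂‖Sx + Tx‖ for all x ∈ D(T), where λ₁ < 1 and −1 < λ₂ < 1. If R(T) is closed, then R(T + S) is closed and γ(T + S) ≥ ((1 − λ₁)/(1 + λ₂)) γ(T); equivalently, ‖(T + S)†‖ ≤ ((1 + λ₂)/(1 − λ₁)) ‖T†‖. -/
/-- The null space `N(T)` of a partially defined operator `T`, as a submodule of the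
ambient space. -/
def pmKer {H₁ H₂ : Type*} [NormedAddCommGroup H₁] [InnerProductSpace ℂ H₁]
    [NormedAddCommGroup H₂] [InnerProductSpace ℂ H₂] (T : H₁ →ₗ.[ℂ] H₂) : Submodule ℂ H₁ :=
  (LinearMap.ker T.toFun).map T.domain.subtype

/-- The range `R(T)` of a partially defined operator `T`. -/
def pmRan {H₁ H₂ : Type*} [NormedAddCommGroup H₁] [InnerProductSpace ℂ H₁]
    [NormedAddCommGroup H₂] [InnerProductSpace ℂ H₂] (T : H₁ →ₗ.[ℂ] H₂) : Submodule ℂ H₂ :=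
  LinearMap.range T.toFun

/-- `Td` is the Moore–Penrose inverse of the closed range, densely defined operator `T`:
it is a bounded operator with range contained in the carrier `C(T) = D(T) ∩ N(T)^⊥`,
`T (T† y) = P_{R(T)} y` for all `y`, `T† (T x) = P_{N(T)^⊥} x` for all `x ∈ D(T)`,
and `N(T†) = R(T)^⊥` (the projection identities are expressed via the characteristic
orthogonality properties of orthogonal projections onto closed subspaces). -/
structure IsMPOf {H₁ H₂ : Type*} [NormedAddCommGroup H₁] [InnerProductSpace ℂ H₁]
    [NormedAddCommGroup H₂] [InnerProductSpace ℂ H₂]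
    (T : H₁ →ₗ.[ℂ] H₂) (Td : H₂ →L[ℂ] H₁) : Prop where
  mem_dom : ∀ y : H₂, Td y ∈ T.domain
  mem_carrier : ∀ y : H₂, Td y ∈ (pmKer T)ᗮ
  proj_ran : ∀ y : H₂, y - T ⟨Td y, mem_dom y⟩ ∈ (pmRan T)ᗮ
  proj_ker : ∀ x : T.domain, (x : H₁) - Td (T x) ∈ pmKer T
  ker_eq : ∀ y : H₂, Td y = 0 ↔ y ∈ (pmRan T)ᗮ

/-- The operator `T + S` with domain `D(T)`, where `T` is partially defined and
`S` is bounded. -/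
def addPM {H₁ H₂ : Type*} [NormedAddCommGroup H₁] [InnerProductSpace ℂ H₁]
    [NormedAddCommGroup H₂] [InnerProductSpace ℂ H₂]
    (T : H₁ →ₗ.[ℂ] H₂) (S : H₁ →L[ℂ] H₂) : H₁ →ₗ.[ℂ] H₂ :=
  ⟨T.domain, T.toFun + (S : H₁ →ₗ[ℂ] H₂).comp T.domain.subtype⟩

/-- The reduced minimum modulus `γ(T) = inf {‖T x‖ : x ∈ C(T), ‖x‖ = 1}`, where
`C(T) = D(T) ∩ N(T)^⊥` is the carrier of `T`. -/
noncomputable def pmGamma {H₁ H₂ : Type*} [NormedAddCommGroup H₁] [InnerProductSpace ℂ H₁]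
    [NormedAddCommGroup H₂] [InnerProductSpace ℂ H₂] (T : H₁ →ₗ.[ℂ] H₂) : ℝ :=
  sInf {r : ℝ | ∃ x : T.domain, (x : H₁) ∈ (pmKer T)ᗮ ∧ ‖(x : H₁)‖ = 1 ∧ r = ‖T x‖}

section
variable {H₁ H₂ : Type*} [NormedAddCommGroup H₁] [InnerProductSpace ℂ H₁]
    [NormedAddCommGroup H₂] [InnerProductSpace ℂ H₂]

theorem mem_pmRan_iff (T : H₁ →ₗ.[ℂ] H₂) (y : H₂) : y ∈ pmRan T ↔ ∃ x : T.domain, T x = y :=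
  Iff.rfl

theorem addPM_apply (T : H₁ →ₗ.[ℂ] H₂) (S : H₁ →L[ℂ] H₂) (x : T.domain) :
    addPM T S x = T x + S (x : H₁) := rfl

/-- Two operators with the same domain and the same vanishing set have the same kernel. -/
theorem pmKer_addPM (T : H₁ →ₗ.[ℂ] H₂) (S : H₁ →L[ℂ] H₂)
    (h : ∀ x : T.domain, T x + S (x : H₁) = 0 ↔ T x = 0) : pmKer (addPM T S) = pmKer T := by
  ext z
  constructor
  · rintro ⟨x, hx, rfl⟩
    exact ⟨x, (h x).1 hx, rfl⟩
  · rintro ⟨x, hx, rfl⟩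
    exact ⟨x, (h x).2 hx, rfl⟩

/-- The range of `T + S` is closed if that of `T` is and the norms of `T x` and `(T + S) x`
are comparable. -/
theorem isClosed_pmRan_addPM [CompleteSpace H₂] (T : H₁ →ₗ.[ℂ] H₂) (S : H₁ →L[ℂ] H₂) (c d : ℝ)
    (hc : ∀ x : T.domain, ‖T x‖ ≤ c * ‖T x + S (x : H₁)‖)
    (hd : ∀ x : T.domain, ‖T x + S (x : H₁)‖ ≤ d * ‖T x‖)
    (hT : IsClosed (pmRan T : Set H₂)) : IsClosed (pmRan (addPM T S) : Set H₂) := by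
  refine IsSeqClosed.isClosed fun u y hu huy => ?_
  have hu' : ∀ n, ∃ x : T.domain, T x + S (x : H₁) = u n := hu
  choose x hx using hu'
  have hsub (a b : T.domain) :
      T (a - b) + S ((a - b : T.domain) : H₁) = (T a + S (a : H₁)) - (T b + S (b : H₁)) := by
    rw [LinearPMap.map_sub, Submodule.coe_sub, map_sub]
    abel
  have hcauchy : CauchySeq fun n => T (x n) := by
    rw [cauchySeq_iff_tendsto_dist_atTop_0]
    have h0 := (cauchySeq_iff_tendsto_dist_atTop_0.1 huy.cauchySeq).const_mul c
    rw [mul_zero] at h0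
    refine squeeze_zero (fun _ => dist_nonneg) (fun p => ?_) h0
    have := hc (x p.1 - x p.2)
    rwa [hsub, hx, hx, LinearPMap.map_sub, ← dist_eq_norm, ← dist_eq_norm] at this
  obtain ⟨z, hz⟩ := cauchySeq_tendsto_of_complete hcauchy
  obtain ⟨w, hw⟩ := (mem_pmRan_iff T z).1
    (hT.mem_of_tendsto hz (Filter.Eventually.of_forall fun n => ⟨x n, rfl⟩))
  have hlim : Filter.Tendsto u Filter.atTop (nhds (T w + S (w : H₁))) := by
    rw [tendsto_iff_dist_tendsto_zero]
    have h0 := (tendsto_iff_dist_tendsto_zero.1 hz).const_mul d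
    rw [mul_zero] at h0
    refine squeeze_zero (fun _ => dist_nonneg) (fun n => ?_) h0
    rw [hw]
    have := hd (x n - w)
    rwa [hsub, hx, LinearPMap.map_sub, hw, ← dist_eq_norm, ← dist_eq_norm] at this
  exact ⟨w, tendsto_nhds_unique hlim huy⟩

theorem IsMPOf.apply_apply {T : H₁ →ₗ.[ℂ] H₂} {Td : H₂ →L[ℂ] H₁} (h : IsMPOf T Td)
    (x : T.domain) (hx : (x : H₁) ∈ (pmKer T)ᗮ) : Td (T x) = x := by
  have h1 := h.proj_ker x
  have h2 : (x : H₁) - Td (T x) ∈ (pmKer T)ᗮ := Submodule.sub_mem _ hx (h.mem_carrier _)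
  exact (sub_eq_zero.1 ((Submodule.disjoint_def.1 (pmKer T).orthogonal_disjoint) _ h1 h2)).symm

theorem IsMPOf.norm_apply_le {T : H₁ →ₗ.[ℂ] H₂} {Td : H₂ →L[ℂ] H₁} (h : IsMPOf T Td)
    (y : H₂) : ‖T ⟨Td y, h.mem_dom y⟩‖ ≤ ‖y‖ := by
  set v := T ⟨Td y, h.mem_dom y⟩ with hv
  have h0 : inner ℂ v (y - v) = 0 :=
    (Submodule.mem_orthogonal _ _).1 (h.proj_ran y) v ⟨_, rfl⟩
  have h1 := norm_add_sq_eq_norm_sq_add_norm_sq_of_inner_eq_zero v (y - v) h0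
  rw [add_sub_cancel] at h1
  nlinarith [norm_nonneg v, norm_nonneg y, mul_self_nonneg ‖y - v‖]

end

/-- Theorem 5.1 (3): if `‖S x‖ ≤ λ₁ ‖T x‖ + λ₂ ‖S x + T x‖` on `D(T)` with `λ₁ < 1`
and `−1 < λ₂ < 1`, and `R(T)` is closed, then `R(T + S)` is closed,
`γ(T + S) ≥ ((1 − λ₁)/(1 + λ₂)) γ(T)`, and equivalently
`‖(T + S)†‖ ≤ ((1 + λ₂)/(1 − λ₁)) ‖T†‖`. -/
theorem stmt16 {H₁ H₂ : Type*} [NormedAddCommGroup H₁] [InnerProductSpace ℂ H₁] [CompleteSpace H₁]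
    [NormedAddCommGroup H₂] [InnerProductSpace ℂ H₂] [CompleteSpace H₂]
    (T : H₁ →ₗ.[ℂ] H₂) (hTclosed : T.IsClosed) (hTdense : Dense (T.domain : Set H₁))
    (S : H₁ →L[ℂ] H₂) (lam1 lam2 : ℝ) (h1 : lam1 < 1) (h2 : -1 < lam2) (h2' : lam2 < 1)
    (hST : ∀ x : T.domain, ‖S (x : H₁)‖ ≤ lam1 * ‖T x‖ + lam2 * ‖S (x : H₁) + T x‖)
    (hTran : IsClosed (pmRan T : Set H₂)) :
    IsClosed (pmRan (addPM T S) : Set H₂) ∧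
      (1 - lam1) / (1 + lam2) * pmGamma T ≤ pmGamma (addPM T S) ∧
      ∀ (Td : H₂ →L[ℂ] H₁) (U : H₂ →L[ℂ] H₁),
        IsMPOf T Td → IsMPOf (addPM T S) U → ‖U‖ ≤ (1 + lam2) / (1 - lam1) * ‖Td‖ := by
  have hp : 0 < 1 - lam1 := by linarith
  have hq : 0 < 1 + lam2 := by linarith
  have hr : 0 < 1 - lam2 := by linarith
  have hlow (x : T.domain) : (1 - lam1) * ‖T x‖ ≤ (1 + lam2) * ‖T x + S (x : H₁)‖ := by
    have h := hST x
    have h' := norm_sub_le (T x + S (x : H₁)) (S (x : H₁))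
    rw [add_sub_cancel_right] at h'
    rw [add_comm (S (x : H₁))] at h
    linarith
  have hup (x : T.domain) : (1 - lam2) * ‖T x + S (x : H₁)‖ ≤ (1 + lam1) * ‖T x‖ := by
    have h := hST x
    have h' := norm_add_le (T x) (S (x : H₁))
    rw [add_comm (S (x : H₁))] at h
    linarith
  have hc (x : T.domain) : ‖T x‖ ≤ (1 + lam2) / (1 - lam1) * ‖T x + S (x : H₁)‖ := by
    rw [div_mul_eq_mul_div, le_div_iff₀ hp]
    linarith [hlow x]
  have hd (x : T.domain) : ‖T x + S (x : H₁)‖ ≤ (1 + lam1) / (1 - lam2) * ‖T x‖ := by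
    rw [div_mul_eq_mul_div, le_div_iff₀ hr]
    linarith [hup x]
  have hker : pmKer (addPM T S) = pmKer T := by
    refine pmKer_addPM T S fun x => ⟨fun h => ?_, fun h => ?_⟩
    · simpa [h] using hc x
    · simpa [h] using hd x
  refine ⟨isClosed_pmRan_addPM T S _ _ hc hd hTran, ?_, fun Td U hTd hU => ?_⟩
  · unfold pmGamma
    rw [hker]
    rcases Set.eq_empty_or_nonempty
      {r : ℝ | ∃ x : (addPM T S).domain,
        (x : H₁) ∈ (pmKer T)ᗮ ∧ ‖(x : H₁)‖ = 1 ∧ r = ‖addPM T S x‖} with he | hne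
    · have he' : {r : ℝ | ∃ x : T.domain,
          (x : H₁) ∈ (pmKer T)ᗮ ∧ ‖(x : H₁)‖ = 1 ∧ r = ‖T x‖} = ∅ := by
        rw [Set.eq_empty_iff_forall_notMem] at he ⊢
        rintro r ⟨x, hx, hx1, -⟩
        exact he _ ⟨x, hx, hx1, rfl⟩
      rw [he, he', Real.sInf_empty, mul_zero]
    · refine le_csInf hne ?_
      rintro r ⟨x, hx, hx1, rfl⟩
      change T.domain at x
      have hle : sInf {r : ℝ | ∃ x : T.domain,
          (x : H₁) ∈ (pmKer T)ᗮ ∧ ‖(x : H₁)‖ = 1 ∧ r = ‖T x‖} ≤ ‖T x‖ := by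
        refine csInf_le ⟨0, ?_⟩ ⟨x, hx, hx1, rfl⟩
        rintro r ⟨x, -, -, rfl⟩
        exact norm_nonneg _
      rw [addPM_apply]
      refine (mul_le_mul_of_nonneg_left hle (by positivity)).trans ?_
      rw [div_mul_eq_mul_div, div_le_iff₀ hq]
      linarith [hlow x]
  · refine U.opNorm_le_bound (by positivity) fun y => ?_
    let x : T.domain := ⟨U y, hU.mem_dom y⟩
    have hx : Td (T x) = U y := hTd.apply_apply x (hker ▸ hU.mem_carrier y)
    have hy : ‖T x + S (x : H₁)‖ ≤ ‖y‖ := hU.norm_apply_le y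
    calc ‖U y‖ = ‖Td (T x)‖ := by rw [hx]
      _ ≤ ‖Td‖ * ‖T x‖ := Td.le_opNorm _
      _ ≤ ‖Td‖ * ((1 + lam2) / (1 - lam1) * ‖y‖) := by
        gcongr
        exact (hc x).trans (by gcongr)
      _ = (1 + lam2) / (1 - lam1) * ‖Td‖ * ‖y‖ := by ring
end

section
/- Let T be a closed densely defined linear operator from H₁ to H₂ and S : H₁ → H₂ a bounded linear operator such that ‖Sx‖ ≤ λ₁‖Tx‖ + λ₂‖Sx + Tx‖ for all x ∈ D(T), where λ₁ < 1 and −1 < λ₂ < 1. If in addition T is surjective (R(T) = H₂), then T + S is surjective, the bounded operator I + S T† : H₂ → H₂ is bijective, and the Moore–Penrose inverse of T + S is given by (T + S)† = T† ∘ (I + S T†)⁻¹. -/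
/-- A bounded operator `A` with `‖A y‖ ≤ a ‖y‖ + b ‖y + A y‖`, where `0 ≤ b < 1`,
satisfies a lower bound for `1 + t A` that is uniform in `t ∈ [0, 1]`. -/
theorem norm_le_norm_add_smul_of_le {E : Type*} [NormedAddCommGroup E] [NormedSpace ℂ E]
    (A : E →L[ℂ] E) {a b : ℝ} (hb : 0 ≤ b) (hb1 : b < 1)
    (hA : ∀ y, ‖A y‖ ≤ a * ‖y‖ + b * ‖y + A y‖) {t : ℝ} (ht : 0 ≤ t) (ht1 : t ≤ 1) (y : E) :
    (1 - a) * ‖y‖ ≤ (1 + b) * ‖y + (t : ℂ) • A y‖ := by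
  set u := y + (t : ℂ) • A y with hu
  have e : y + A y = u + ((1 - t : ℝ) : ℂ) • A y := by
    rw [hu]; push_cast; module
  have n1 : ‖y + A y‖ ≤ ‖u‖ + (1 - t) * ‖A y‖ := by
    rw [e]
    refine (norm_add_le _ _).trans_eq ?_
    rw [norm_smul, Complex.norm_of_nonneg (by linarith)]
  have n2 : ‖y‖ ≤ ‖u‖ + t * ‖A y‖ := by
    have : y = u - (t : ℂ) • A y := by rw [hu]; module
    calc ‖y‖ = ‖u - (t : ℂ) • A y‖ := by rw [← this]
      _ ≤ ‖u‖ + ‖(t : ℂ) • A y‖ := norm_sub_le _ _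
      _ = _ := by rw [norm_smul, Complex.norm_of_nonneg ht]
  have n3 : (1 - b * (1 - t)) * ‖A y‖ ≤ a * ‖y‖ + b * ‖u‖ := by
    nlinarith [hA y, mul_le_mul_of_nonneg_left n1 hb]
  have n4 : t ≤ 1 - b * (1 - t) := by nlinarith
  nlinarith [mul_le_mul_of_nonneg_right n4 (norm_nonneg (A y))]

/-- Perturbation of the identity: if `‖A y‖ ≤ a ‖y‖ + b ‖y + A y‖` with `a, b < 1`, then
`1 + A` is invertible. -/
theorem isUnit_one_add_of_norm_le {E : Type*} [NormedAddCommGroup E] [NormedSpace ℂ E]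
    [CompleteSpace E] (A : E →L[ℂ] E) {a b : ℝ} (ha : a < 1) (hb : b < 1)
    (hA : ∀ y, ‖A y‖ ≤ a * ‖y‖ + b * ‖y + A y‖) : IsUnit (1 + A) := by
  wlog hb0 : 0 ≤ b generalizing a b
  · refine this (b := max b 0) ha (by simp [hb]) (fun y => ?_) (le_max_right _ _)
    refine (hA y).trans ?_
    gcongr
    exact le_max_left _ _
  have key := fun t : ℝ => norm_le_norm_add_smul_of_le A hb0 hb hA (t := t)
  set C : ℝ := (1 + b) / (1 - a) with hC
  have hC0 : 0 ≤ C := div_nonneg (by linarith) (by linarith)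
  obtain ⟨N, hN⟩ := exists_nat_gt (C * ‖A‖)
  have hN0 : (0 : ℝ) < N := lt_of_le_of_lt (by positivity) hN
  have step : ∀ k : ℕ, k ≤ N → IsUnit (1 + (((k / N : ℝ)) : ℂ) • A) := by
    intro k
    induction k with
    | zero => intro _; simp
    | succ k ih =>
      intro hk
      obtain ⟨X, hX⟩ := ih (by omega)
      have hkN : (k : ℝ) / N ≤ 1 := by
        rw [div_le_one hN0]; exact_mod_cast (by omega : k ≤ N)
      have hinv : ‖(↑X⁻¹ : E →L[ℂ] E)‖ ≤ C := by
        refine ContinuousLinearMap.opNorm_le_bound _ hC0 fun z => ?_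
        have h := key (k / N) (by positivity) hkN ((↑X⁻¹ : E →L[ℂ] E) z)
        have hz : (X : E →L[ℂ] E) ((↑X⁻¹ : E →L[ℂ] E) z) = z := by
          rw [← mul_apply_eq_comp, X.mul_inv, one_apply_eq_self]
        rw [hX] at hz
        have hz' : (↑X⁻¹ : E →L[ℂ] E) z + (((k / N : ℝ)) : ℂ) • A ((↑X⁻¹ : E →L[ℂ] E) z) = z := by
          simpa using hz
        rw [hz'] at h
        rw [hC, div_mul_eq_mul_div, le_div_iff₀ (by linarith)]
        linarith
      set B : E →L[ℂ] E := -(((1 / N : ℝ) : ℂ) • ((↑X⁻¹ : E →L[ℂ] E) * A)) with hB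
      have hBn : ‖B‖ < 1 := by
        rw [hB, norm_neg, norm_smul, Complex.norm_of_nonneg (by positivity)]
        have : ‖(↑X⁻¹ : E →L[ℂ] E) * A‖ ≤ C * ‖A‖ :=
          (norm_mul_le _ _).trans (by gcongr)
        rw [one_div, inv_mul_lt_iff₀ hN0]
        linarith
      have hfac : 1 + ((((k + 1 : ℕ) / N : ℝ)) : ℂ) • A = (X : E →L[ℂ] E) * (1 - B) := by
        rw [hB, sub_neg_eq_add, mul_add, mul_one, mul_smul_comm, ← mul_assoc, X.mul_inv, one_mul,
          hX, add_assoc, ← add_smul]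
        congr 2
        push_cast
        ring
      rw [hfac]
      exact X.isUnit.mul (isUnit_one_sub_of_norm_lt_one hBn)
  simpa [div_self hN0.ne'] using step N le_rfl

section

variable {H₁ H₂ : Type*} [NormedAddCommGroup H₁] [InnerProductSpace ℂ H₁]
  [NormedAddCommGroup H₂] [InnerProductSpace ℂ H₂]

theorem mem_pmKer_iff (T : H₁ →ₗ.[ℂ] H₂) (x : H₁) :
    x ∈ pmKer T ↔ ∃ h : x ∈ T.domain, T ⟨x, h⟩ = 0 := by
  simp [pmKer, Submodule.mem_map]

theorem pmRan_orthogonal_eq_bot {T : H₁ →ₗ.[ℂ] H₂} (hT : ∀ y : H₂, ∃ x : T.domain, T x = y) :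
    (pmRan T)ᗮ = ⊥ := by
  have : pmRan T = ⊤ := LinearMap.range_eq_top.2 hT
  rw [this, Submodule.top_orthogonal_eq_bot]

/-- The relative bound on `S` forces `T` and `T + S` to have the same kernel. -/
theorem pmKer_addPM_of_norm_le (T : H₁ →ₗ.[ℂ] H₂) (S : H₁ →L[ℂ] H₂) {a b : ℝ}
    (ha : a < 1) (hb : b < 1)
    (hST : ∀ x : T.domain, ‖S (x : H₁)‖ ≤ a * ‖T x‖ + b * ‖S (x : H₁) + T x‖) :
    pmKer (addPM T S) = pmKer T := by
  ext x
  rw [mem_pmKer_iff, mem_pmKer_iff]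
  refine exists_congr fun h => ?_
  change T ⟨x, h⟩ + S x = 0 ↔ _
  have hx := hST ⟨x, h⟩
  constructor <;> intro h0
  · rw [add_comm (S _), h0, norm_zero, mul_zero, add_zero, eq_neg_of_add_eq_zero_left h0,
      norm_neg] at hx
    have : ‖S x‖ = 0 := by nlinarith [norm_nonneg (S x)]
    rw [norm_eq_zero] at this
    simpa [this] using h0
  · rw [h0, norm_zero, mul_zero, zero_add, add_zero] at hx
    have : ‖S x‖ = 0 := by nlinarith [norm_nonneg (S x)]
    rw [norm_eq_zero] at this
    rw [h0, this, add_zero]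

end

/-- Theorem 5.1 (4): if `‖S x‖ ≤ λ₁ ‖T x‖ + λ₂ ‖S x + T x‖` on `D(T)` with `λ₁ < 1`
and `−1 < λ₂ < 1`, and `T` is onto, then `T + S` is onto, `I + S T†` is bijective and
`(T + S)† = T† (I + S T†)⁻¹`. -/
theorem stmt17 {H₁ H₂ : Type*} [NormedAddCommGroup H₁] [InnerProductSpace ℂ H₁] [CompleteSpace H₁]
    [NormedAddCommGroup H₂] [InnerProductSpace ℂ H₂] [CompleteSpace H₂]
    (T : H₁ →ₗ.[ℂ] H₂) (hTclosed : T.IsClosed) (hTdense : Dense (T.domain : Set H₁))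
    (S : H₁ →L[ℂ] H₂) (lam1 lam2 : ℝ) (h1 : lam1 < 1) (h2 : -1 < lam2) (h2' : lam2 < 1)
    (hST : ∀ x : T.domain, ‖S (x : H₁)‖ ≤ lam1 * ‖T x‖ + lam2 * ‖S (x : H₁) + T x‖)
    (hTsurj : ∀ y : H₂, ∃ x : T.domain, T x = y)
    (Td : H₂ →L[ℂ] H₁) (hMP : IsMPOf T Td) :
    (∀ y : H₂, ∃ x : T.domain, T x + S (x : H₁) = y) ∧
      Function.Bijective ⇑(ContinuousLinearMap.id ℂ H₂ + S.comp Td) ∧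
      ∃ W : H₂ →L[ℂ] H₂,
        W.comp (ContinuousLinearMap.id ℂ H₂ + S.comp Td) = ContinuousLinearMap.id ℂ H₂ ∧
        (ContinuousLinearMap.id ℂ H₂ + S.comp Td).comp W = ContinuousLinearMap.id ℂ H₂ ∧
        IsMPOf (addPM T S) (Td.comp W) := by
  have hbot := pmRan_orthogonal_eq_bot hTsurj
  have hTTd : ∀ y, T ⟨Td y, hMP.mem_dom y⟩ = y := fun y => by
    have h := hMP.proj_ran y
    rw [hbot, Submodule.mem_bot, sub_eq_zero] at h
    exact h.symm
  have hunit : IsUnit (1 + S.comp Td) := by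
    refine isUnit_one_add_of_norm_le (S.comp Td) h1 h2' fun y => ?_
    have h := hST ⟨Td y, hMP.mem_dom y⟩
    rw [hTTd, add_comm (S _)] at h
    exact h
  obtain ⟨X, hX⟩ := hunit
  set W : H₂ →L[ℂ] H₂ := ↑X⁻¹ with hW
  have hWl : W.comp (ContinuousLinearMap.id ℂ H₂ + S.comp Td) = ContinuousLinearMap.id ℂ H₂ := by
    change W * (1 + S.comp Td) = 1
    rw [← hX, hW, X.inv_mul]
  have hWr : (ContinuousLinearMap.id ℂ H₂ + S.comp Td).comp W = ContinuousLinearMap.id ℂ H₂ := by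
    change (1 + S.comp Td) * W = 1
    rw [← hX, hW, X.mul_inv]
  have hWr' : ∀ y, W y + S (Td (W y)) = y := fun y => DFunLike.congr_fun hWr y
  have hright : ∀ y, addPM T S ⟨Td (W y), hMP.mem_dom (W y)⟩ = y := fun y => by
    change T ⟨Td (W y), hMP.mem_dom (W y)⟩ + S (Td (W y)) = y
    rw [hTTd]
    exact hWr' y
  have hsurj : ∀ y : H₂, ∃ x : (addPM T S).domain, addPM T S x = y := fun y => ⟨_, hright y⟩
  have hbot' := pmRan_orthogonal_eq_bot hsurj
  refine ⟨hsurj, ⟨Function.LeftInverse.injective (g := W) (DFunLike.congr_fun hWl),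
    Function.RightInverse.surjective (g := W) (DFunLike.congr_fun hWr)⟩, W, hWl, hWr, ?_⟩
  refine ⟨fun y => hMP.mem_dom (W y), fun y => ?_, fun y => ?_, fun x => ?_, fun y => ?_⟩
  · rw [pmKer_addPM_of_norm_le T S h1 h2' hST]
    exact hMP.mem_carrier (W y)
  · have h : addPM T S ⟨(Td.comp W) y, hMP.mem_dom (W y)⟩ = y := hright y
    rw [h, sub_self]
    exact zero_mem _
  · rw [mem_pmKer_iff]
    refine ⟨(addPM T S).domain.sub_mem x.2 (hMP.mem_dom (W _)), ?_⟩
    have h := (addPM T S).map_sub x ⟨Td (W (addPM T S x)), hMP.mem_dom _⟩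
    rw [hright, sub_self] at h
    exact h
  · rw [hbot', Submodule.mem_bot, ContinuousLinearMap.comp_apply, hMP.ker_eq, hbot,
      Submodule.mem_bot]
    refine ⟨fun h => ?_, fun h => by rw [h, map_zero]⟩
    have h' := hWr' y
    rw [h, map_zero, map_zero, add_zero] at h'
    exact h'.symm
end
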